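/- The group B(4,3) is isomorphic to RAAG(Γ), where Γ is the simple graph with seven vertices v_1, …, v_7 whose only edges are {v_1,v_2}, {v_2,v_3}, {v_3,v_4}, {v_4,v_1} (a 4-cycle together with three isolated vertices). -/

import Mathlib

/-- Generators of the presentation of `B(p,q)`: triples `(t, ℓ, i)` with `t ∈ Fin 3`
(`t = 0` for `a`, `t = 1` for `b`, `t = 2` for `c`), `1 ≤ ℓ ≤ q - 1`, `1 ≤ i ≤ p - 1`. -/
def BGen (p q : ℕ) : Type :=
  {x : Fin 3 × ℕ × ℕ // 1 ≤ x.2.1 ∧ x.2.1 ≤ q - 1 ∧ 1 ≤ x.2.2 ∧ x.2.2 ≤ p - 1}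

/-- The generator `a_{ℓ,i}` (as an element of the free group), or `1` if out of range. -/
def ga (p q ℓ i : ℕ) : FreeGroup (BGen p q) :=
  if h : 1 ≤ ℓ ∧ ℓ ≤ q - 1 ∧ 1 ≤ i ∧ i ≤ p - 1 then FreeGroup.of ⟨(0, ℓ, i), h⟩ else 1

/-- The generator `b_{ℓ,i}`, or `1` if out of range. -/
def gb (p q ℓ i : ℕ) : FreeGroup (BGen p q) :=
  if h : 1 ≤ ℓ ∧ ℓ ≤ q - 1 ∧ 1 ≤ i ∧ i ≤ p - 1 then FreeGroup.of ⟨(1, ℓ, i), h⟩ else 1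

/-- The generator `c_{ℓ,i}`, or `1` if out of range. -/
def gc (p q ℓ i : ℕ) : FreeGroup (BGen p q) :=
  if h : 1 ≤ ℓ ∧ ℓ ≤ q - 1 ∧ 1 ≤ i ∧ i ≤ p - 1 then FreeGroup.of ⟨(2, ℓ, i), h⟩ else 1

/-- The commutator `[x, y] = x * y * x⁻¹ * y⁻¹`. -/
def gcomm {G : Type*} [Group G] (x y : G) : G := x * y * x⁻¹ * y⁻¹

/-- The relators (R1)–(R5) of the presentation of `B(p,q)`. -/
def Brels (p q : ℕ) : Set (FreeGroup (BGen p q)) :=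
  {r | r = ga p q 1 1 ∨ r = gc p q (q - 1) 1
    ∨ (∃ ℓ i j, 1 ≤ ℓ ∧ ℓ ≤ q - 1 ∧ 1 ≤ i ∧ i < j ∧ j ≤ p - 1 ∧
        r = gb p q ℓ i * ga p q ℓ j * (gb p q ℓ i)⁻¹ * (gc p q ℓ j)⁻¹)
    ∨ (∃ ℓ i j, 1 ≤ ℓ ∧ ℓ ≤ q - 2 ∧ 1 ≤ i ∧ i ≤ p - 1 ∧ 1 ≤ j ∧ j ≤ p - i ∧
        r = gc p q ℓ i * ga p q (ℓ + 1) j * (gb p q ℓ i)⁻¹ * (gb p q (ℓ + 1) j)⁻¹)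
    ∨ (∃ ℓ i j, 1 ≤ ℓ ∧ ℓ ≤ q - 2 ∧ 3 ≤ i ∧ i ≤ p - 1 ∧ 3 ≤ j ∧ j ≤ p - 1 ∧ p + 2 ≤ i + j ∧
        r = gcomm (gc p q ℓ i) (ga p q (ℓ + 1) j))
    ∨ (∃ ℓ lam i j, 2 ≤ ℓ + 1 ∧ ℓ + 1 < lam ∧ lam ≤ q - 1 ∧
        1 ≤ i ∧ i ≤ p - 1 ∧ 1 ≤ j ∧ j ≤ p - 1 ∧
        r = gcomm (gc p q ℓ i) (ga p q lam j))}

/-- The square-section braid group `B(p,q) = B_{pq-2}(p × q)`, via its presentation. -/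
abbrev B (p q : ℕ) : Type := PresentedGroup (Brels p q)

/-- The RAAG relators of a simple graph: one commutator for each edge. -/
def RAAGrels {V : Type*} (Γ : SimpleGraph V) : Set (FreeGroup V) :=
  {r | ∃ u v : V, Γ.Adj u v ∧ r = gcomm (FreeGroup.of u) (FreeGroup.of v)}

/-- The right-angled Artin group of a simple graph. -/
abbrev RAAG {V : Type*} (Γ : SimpleGraph V) : Type _ := PresentedGroup (RAAGrels Γ)

/-- The graph on seven vertices `0,…,6` whose only edges are `{0,1}`, `{1,2}`, `{2,3}`,
`{3,0}`: a 4-cycle together with three isolated vertices. -/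
def squarePlusThree : SimpleGraph (Fin 7) :=
  SimpleGraph.fromRel (fun u v =>
    (u = 0 ∧ v = 1) ∨ (u = 1 ∧ v = 2) ∨ (u = 2 ∧ v = 3) ∨ (u = 3 ∧ v = 0))

/-- The images of the generators of `B(4,3)` prescribed by seven elements `x 0, …, x 6` of a group.
The types `0`, `1`, `2` stand for `a`, `b`, `c`. -/
def genImage {G : Type*} [Group G] (x : Fin 7 → G) : Fin 3 → ℕ → ℕ → G
  | 0, 1, 2 => (x 4 * x 6)⁻¹ * (x 5 * x 0) * (x 4 * x 6)
  | 0, 1, 3 => (x 6)⁻¹ * x 3 * x 6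
  | 0, 2, 1 => x 6
  | 0, 2, 2 => x 1 * x 6
  | 0, 2, 3 => x 4 * x 2 * (x 4)⁻¹
  | 1, 1, 1 => x 4 * x 6
  | 1, 1, 2 => x 4 * x 0 * x 6
  | 1, 1, 3 => x 4 * (x 5)⁻¹ * x 4 * x 3 * (x 4)⁻¹ * x 6
  | 1, 2, 1 => x 5 * (x 4)⁻¹
  | 1, 2, 2 => x 5 * x 1 * (x 4)⁻¹
  | 1, 2, 3 => x 5 * x 4 * x 2 * (x 4)⁻¹ * (x 6)⁻¹ * (x 4)⁻¹
  | 2, 1, 1 => x 5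
  | 2, 1, 2 => x 5 * x 0
  | 2, 1, 3 => x 4 * x 3 * (x 4)⁻¹
  | 2, 2, 2 => x 5 * (x 4)⁻¹ * (x 1 * x 6) * (x 5 * (x 4)⁻¹)⁻¹
  | 2, 2, 3 => x 5 * x 2 * (x 5)⁻¹
  | _, _, _ => 1

/-- Seven group elements whose cyclically consecutive pairs among the first four commute. -/
structure IsSquareTuple {G : Type*} [Group G] (x : Fin 7 → G) : Prop where
  comm01 : Commute (x 0) (x 1)
  comm12 : Commute (x 1) (x 2)
  comm23 : Commute (x 2) (x 3)
  comm30 : Commute (x 3) (x 0)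

lemma gcomm_eq_one_iff {G : Type*} [Group G] {u v : G} : gcomm u v = 1 ↔ Commute u v := by
  rw [gcomm, commute_iff_eq, mul_inv_eq_one, mul_inv_eq_iff_eq_mul]

lemma map_gcomm {G H : Type*} [Group G] [Group H] (f : G →* H) (u v : G) :
    f (gcomm u v) = gcomm (f u) (f v) := by
  simp [gcomm]

lemma IsSquareTuple.lift_eq_one {G : Type*} [Group G] {x : Fin 7 → G}
    (hx : IsSquareTuple x) (r : FreeGroup (Fin 7)) (hr : r ∈ RAAGrels squarePlusThree) :
    FreeGroup.lift x r = 1 := by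
  obtain ⟨u, v, huv, rfl⟩ := hr
  rw [map_gcomm, gcomm_eq_one_iff, FreeGroup.lift_apply_of, FreeGroup.lift_apply_of]
  rw [squarePlusThree, SimpleGraph.fromRel_adj] at huv
  rcases huv with ⟨-, (⟨rfl, rfl⟩ | ⟨rfl, rfl⟩ | ⟨rfl, rfl⟩ | ⟨rfl, rfl⟩) |
    (⟨rfl, rfl⟩ | ⟨rfl, rfl⟩ | ⟨rfl, rfl⟩ | ⟨rfl, rfl⟩)⟩
  exacts [hx.comm01, hx.comm12, hx.comm23, hx.comm30,
    hx.comm01.symm, hx.comm12.symm, hx.comm23.symm, hx.comm30.symm]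

/-- A square tuple in `G` induces a homomorphism from the RAAG to `G`. -/
def IsSquareTuple.homOfRAAG {G : Type*} [Group G] {x : Fin 7 → G} (hx : IsSquareTuple x) :
    RAAG squarePlusThree →* G :=
  PresentedGroup.toGroup hx.lift_eq_one

lemma isSquareTuple_raag :
    IsSquareTuple (fun i => (PresentedGroup.of i : RAAG squarePlusThree)) := by
  have key (u v : Fin 7) (h : squarePlusThree.Adj u v) :
      Commute (PresentedGroup.of u : RAAG squarePlusThree) (PresentedGroup.of v) := by
    rw [← gcomm_eq_one_iff, PresentedGroup.of, PresentedGroup.of, ← map_gcomm]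
    exact PresentedGroup.one_of_mem ⟨u, v, h, rfl⟩
  constructor <;> apply key <;> simp [squarePlusThree]

/-- The relations of `B(4,3)` that hold for elements `y t ℓ i` of a group, where the types
`0`, `1`, `2` stand for `a`, `b`, `c`. -/
structure IsBTuple {G : Type*} [Group G] (y : Fin 3 → ℕ → ℕ → G) : Prop where
  a_one : y 0 1 1 = 1
  c_one : y 2 2 1 = 1
  conj : ∀ ℓ i j, 1 ≤ ℓ → ℓ ≤ 2 → 1 ≤ i → i < j → j ≤ 3 →
    y 1 ℓ i * y 0 ℓ j * (y 1 ℓ i)⁻¹ = y 2 ℓ j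
  swap : ∀ i j, 1 ≤ i → i ≤ 3 → 1 ≤ j → i + j ≤ 4 → y 2 1 i * y 0 2 j = y 1 2 j * y 1 1 i
  comm : Commute (y 2 1 3) (y 0 2 3)

lemma IsSquareTuple.isBTuple {G : Type*} [Group G] {x : Fin 7 → G} (hx : IsSquareTuple x) :
    IsBTuple (genImage x) where
  a_one := rfl
  c_one := rfl
  conj ℓ i j h1 h2 h3 h4 h5 := by
    have h12 := hx.comm12.eq
    have h30 := hx.comm30.eq
    have hi : i ≤ 2 := by omega
    interval_cases ℓ <;> interval_cases i <;> interval_cases j <;>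
      simp [genImage, mul_assoc] at h4 ⊢
    · rw [← mul_assoc (x 0), ← h30]
      simp [mul_assoc]
    · rw [← mul_assoc (x 1), h12]
      simp [mul_assoc]
  swap i j h1 h2 h3 h4 := by
    have h01 := hx.comm01.eq
    have hj : j ≤ 3 := by omega
    interval_cases i <;> interval_cases j <;> simp [genImage, mul_assoc] at h4 ⊢
    rw [← mul_assoc (x 0), h01, mul_assoc]
  comm := by simpa [genImage] using hx.comm23.symm

lemma IsBTuple.lift_eq_one {G : Type*} [Group G] {y : Fin 3 → ℕ → ℕ → G} (hy : IsBTuple y)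
    (r : FreeGroup (BGen 4 3)) (hr : r ∈ Brels 4 3) :
    FreeGroup.lift (fun g : BGen 4 3 => y g.1.1 g.1.2.1 g.1.2.2) r = 1 := by
  set φ := FreeGroup.lift (fun g : BGen 4 3 => y g.1.1 g.1.2.1 g.1.2.2)
  have ha (ℓ i : ℕ) (h : 1 ≤ ℓ ∧ ℓ ≤ 2 ∧ 1 ≤ i ∧ i ≤ 3) : φ (ga 4 3 ℓ i) = y 0 ℓ i := by
    rw [ga, dif_pos h]
    exact FreeGroup.lift_apply_of
  have hb (ℓ i : ℕ) (h : 1 ≤ ℓ ∧ ℓ ≤ 2 ∧ 1 ≤ i ∧ i ≤ 3) : φ (gb 4 3 ℓ i) = y 1 ℓ i := by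
    rw [gb, dif_pos h]
    exact FreeGroup.lift_apply_of
  have hc (ℓ i : ℕ) (h : 1 ≤ ℓ ∧ ℓ ≤ 2 ∧ 1 ≤ i ∧ i ≤ 3) : φ (gc 4 3 ℓ i) = y 2 ℓ i := by
    rw [gc, dif_pos h]
    exact FreeGroup.lift_apply_of
  rcases hr with rfl | rfl | ⟨ℓ, i, j, h1, h2, h3, h4, h5, rfl⟩ |
    ⟨ℓ, i, j, h1, h2, h3, h4, h5, h6, rfl⟩ | ⟨ℓ, i, j, h1, h2, h3, h4, h5, h6, h7, rfl⟩ |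
    ⟨ℓ, lam, i, j, h1, h2, h3, h4, h5, h6, h7, rfl⟩
  · rw [ha 1 1 (by omega), hy.a_one]
  · rw [hc 2 1 (by omega), hy.c_one]
  · simp only [map_mul, map_inv]
    rw [ha ℓ j (by omega), hb ℓ i (by omega), hc ℓ j (by omega), mul_inv_eq_one]
    exact hy.conj ℓ i j h1 h2 h3 h4 h5
  · obtain rfl : ℓ = 1 := by omega
    simp only [map_mul, map_inv]
    rw [ha (1 + 1) j (by omega), hb 1 i (by omega), hb (1 + 1) j (by omega), hc 1 i (by omega),
      mul_assoc, ← mul_inv_rev, mul_inv_eq_one]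
    exact hy.swap i j h3 h4 h5 (by omega)
  · obtain rfl : ℓ = 1 := by omega
    obtain rfl : i = 3 := by omega
    obtain rfl : j = 3 := by omega
    rw [map_gcomm, gcomm_eq_one_iff, ha (1 + 1) 3 (by omega), hc 1 3 (by omega)]
    exact hy.comm
  · omega

/-- The homomorphism `B(4,3) → G` given by elements of `G` that satisfy the relations. -/
def IsBTuple.homOfB {G : Type*} [Group G] {y : Fin 3 → ℕ → ℕ → G} (hy : IsBTuple y) :
    B 4 3 →* G :=
  PresentedGroup.toGroup hy.lift_eq_one

/-- The elements of a group with the relations of `B(4,3)` that play the role of the vertices of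
the square and of the three isolated vertices. -/
def vertexImage {G : Type*} [Group G] (y : Fin 3 → ℕ → ℕ → G) : Fin 7 → G :=
  ![(y 2 1 1)⁻¹ * y 2 1 2,
    y 0 2 2 * (y 0 2 1)⁻¹,
    (y 1 1 1 * (y 0 2 1)⁻¹)⁻¹ * y 0 2 3 * (y 1 1 1 * (y 0 2 1)⁻¹),
    (y 1 1 1 * (y 0 2 1)⁻¹)⁻¹ * y 2 1 3 * (y 1 1 1 * (y 0 2 1)⁻¹),
    y 1 1 1 * (y 0 2 1)⁻¹,
    y 2 1 1,
    y 0 2 1]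

namespace IsBTuple

variable {G : Type*} [Group G] {y : Fin 3 → ℕ → ℕ → G}

lemma genImage_vertexImage (hy : IsBTuple y) (t : Fin 3) (ℓ i : ℕ) (h1 : 1 ≤ ℓ) (h2 : ℓ ≤ 2)
    (h3 : 1 ≤ i) (h4 : i ≤ 3) : genImage (vertexImage y) t ℓ i = y t ℓ i := by
  have hb (j : ℕ) (hj : 1 ≤ j) (hj' : j ≤ 3) : y 1 2 j = y 2 1 1 * y 0 2 j * (y 1 1 1)⁻¹ :=
    eq_mul_inv_of_mul_eq (hy.swap 1 j le_rfl (by norm_num) hj (by omega)).symm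
  have hb' (j : ℕ) (hj : 1 ≤ j) (hj' : j ≤ 3) : y 1 1 j = (y 1 2 1)⁻¹ * (y 2 1 j * y 0 2 1) :=
    eq_inv_mul_of_mul_eq (hy.swap j 1 hj hj' le_rfl (by omega)).symm
  have hc (ℓ j : ℕ) (h1 : 1 ≤ ℓ) (h2 : ℓ ≤ 2) (hj : 1 < j) (hj' : j ≤ 3) :=
    hy.conj ℓ 1 j h1 h2 le_rfl hj hj'
  have ha (j : ℕ) (hj : 1 < j) (hj' : j ≤ 3) : y 0 1 j = (y 1 1 1)⁻¹ * y 2 1 j * y 1 1 1 := by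
    rw [← hc 1 j le_rfl (by norm_num) hj hj']
    group
  fin_cases t <;> interval_cases ℓ <;> interval_cases i <;>
    simp [genImage, vertexImage, hy.a_one, hy.c_one, mul_assoc]
  · simp [ha 2, mul_assoc]
  · simp [ha 3, mul_assoc]
  · simp [hb' 2, hb 1, mul_assoc]
  · simp [hb' 3, hb 1, mul_assoc]
  · simp [hb 1, mul_assoc]
  · simp [hb 2, mul_assoc]
  · simp [hb 3, mul_assoc]
  · simp [← hc 2 2, hb 1, mul_assoc]
  · simp [← hc 2 3, hb 1, mul_assoc]

lemma isSquareTuple (hy : IsBTuple y) : IsSquareTuple (vertexImage y) := by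
  have hg := hy.genImage_vertexImage
  have e1 := hy.swap 2 2 (by norm_num) (by norm_num) (by norm_num) (by norm_num)
  have e2 := hy.conj 1 2 3 (by norm_num) (by norm_num) (by norm_num) (by norm_num) (by norm_num)
  have e3 := hy.conj 2 2 3 (by norm_num) (by norm_num) (by norm_num) (by norm_num) (by norm_num)
  have e4 := hy.comm
  simp only [← hg 0 1 3, ← hg 0 2 2, ← hg 0 2 3, ← hg 1 1 2, ← hg 1 2 2, ← hg 2 1 2, ← hg 2 1 3,
    ← hg 2 2 3, le_refl, Nat.one_le_ofNat, Nat.reduceLeDiff] at e1 e2 e3 e4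
  generalize vertexImage y = x at *
  simp only [genImage] at e1 e2 e3 e4
  refine ⟨?_, ?_, ?_, ?_⟩
  · rw [commute_iff_eq]
    exact mul_right_cancel (b := x 6) (by simpa [mul_assoc] using e1)
  · rw [commute_iff_eq, ← mul_inv_eq_iff_eq_mul]
    exact mul_right_cancel (b := (x 5)⁻¹) (by simpa [mul_assoc] using e3)
  · simpa using e4.symm
  · rw [commute_iff_eq, eq_comm, ← mul_inv_eq_iff_eq_mul]
    exact mul_right_cancel (b := (x 4)⁻¹) (by simpa [mul_assoc] using e2)

end IsBTuple

/-- The generators of `B(4,3)` as elements of the group, or `1` if out of range. -/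
def bElt (t : Fin 3) (ℓ i : ℕ) : B 4 3 :=
  PresentedGroup.mk _ (![ga 4 3 ℓ i, gb 4 3 ℓ i, gc 4 3 ℓ i] t)

lemma isBTuple_bElt : IsBTuple bElt where
  a_one := PresentedGroup.one_of_mem (Or.inl rfl)
  c_one := PresentedGroup.one_of_mem (Or.inr (Or.inl rfl))
  conj ℓ i j h1 h2 h3 h4 h5 := by
    rw [← mul_inv_eq_one]
    exact PresentedGroup.one_of_mem
      (Or.inr (Or.inr (Or.inl ⟨ℓ, i, j, h1, h2, h3, h4, h5, rfl⟩)))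
  swap i j h1 h2 h3 h4 := by
    rw [← mul_inv_eq_one, mul_inv_rev, ← mul_assoc]
    exact PresentedGroup.one_of_mem (Or.inr (Or.inr (Or.inr (Or.inl
      ⟨1, i, j, le_rfl, le_rfl, h1, h2, h3, by omega, rfl⟩))))
  comm := by
    rw [← gcomm_eq_one_iff]
    exact PresentedGroup.one_of_mem (Or.inr (Or.inr (Or.inr (Or.inr (Or.inl
      ⟨1, 3, 3, le_rfl, le_rfl, le_rfl, le_rfl, le_rfl, le_rfl, le_rfl, rfl⟩)))))

lemma of_eq_bElt (g : BGen 4 3) :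
    (PresentedGroup.of g : B 4 3) = bElt g.1.1 g.1.2.1 g.1.2.2 := by
  obtain ⟨⟨t, ℓ, i⟩, h⟩ := g
  refine congrArg (PresentedGroup.mk _) ?_
  have h' : 1 ≤ ℓ ∧ ℓ ≤ 3 - 1 ∧ 1 ≤ i ∧ i ≤ 4 - 1 := h
  fin_cases t
  · change _ = ga 4 3 ℓ i
    rw [ga, dif_pos h']
    rfl
  · change _ = gb 4 3 ℓ i
    rw [gb, dif_pos h']
    rfl
  · change _ = gc 4 3 ℓ i
    rw [gc, dif_pos h']
    rfl

lemma map_genImage {G H : Type*} [Group G] [Group H] (f : G →* H) (x : Fin 7 → G)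
    (t : Fin 3) (ℓ i : ℕ) : f (genImage x t ℓ i) = genImage (f ∘ x) t ℓ i := by
  unfold genImage
  split <;> simp

lemma IsBTuple.homOfB_bElt {G : Type*} [Group G] {y : Fin 3 → ℕ → ℕ → G} (hy : IsBTuple y)
    (t : Fin 3) (ℓ i : ℕ) (h : 1 ≤ ℓ ∧ ℓ ≤ 2 ∧ 1 ≤ i ∧ i ≤ 3) :
    hy.homOfB (bElt t ℓ i) = y t ℓ i := by
  rw [← of_eq_bElt ⟨(t, ℓ, i), h⟩]
  exact PresentedGroup.toGroup.of _

/-- **Example.** `B(4,3)` is isomorphic to the RAAG of a 4-cycle plus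
three isolated vertices. -/
theorem B43_iso_RAAG_square_plus_three :
    Nonempty (B 4 3 ≃* RAAG squarePlusThree) := by
  let f := isSquareTuple_raag.isBTuple.homOfB
  let g := isBTuple_bElt.isSquareTuple.homOfRAAG
  have hg (k : Fin 7) : g (PresentedGroup.of k) = vertexImage bElt k :=
    PresentedGroup.toGroup.of _
  have hf (t : Fin 3) (ℓ i : ℕ) (h : 1 ≤ ℓ ∧ ℓ ≤ 2 ∧ 1 ≤ i ∧ i ≤ 3) :=
    isSquareTuple_raag.isBTuple.homOfB_bElt t ℓ i h
  refine ⟨MonoidHom.toMulEquiv f g (PresentedGroup.ext ?_) (PresentedGroup.ext ?_)⟩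
  · intro w
    obtain ⟨h1, h2, h3, h4⟩ := w.2
    rw [of_eq_bElt, MonoidHom.comp_apply, hf _ _ _ ⟨h1, h2, h3, h4⟩, map_genImage,
      show g ∘ (fun i => PresentedGroup.of i) = vertexImage bElt from funext hg]
    exact isBTuple_bElt.genImage_vertexImage _ _ _ h1 h2 h3 h4
  · intro k
    rw [MonoidHom.comp_apply, hg]
    fin_cases k <;> simp [vertexImage, f, hf, genImage, mul_assoc]
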